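/- arXiv:math/0606471 — 2 statements merged into one kernel-verified Lean document; each statement's English description precedes it below -/
import Mathlib

section
/- Suppose f is convex on (0, ∞). Fix k with 1 ≤ k ≤ n, a previous stock price s_{k−1} > 0, a bond price b_{k−1} = b_0 (1+r)^{k−1} with b_0 > 0, and a jump ξ with d ≤ ξ ≤ u; set s_k = s_{k−1} ξ and b_k = b_{k−1}(1+r). Then the liquidation value of the time-(k−1) portfolio is at least the new set-up cost: γ_{k−1}(u,d) · s_k + β_{k−1}(u,d) · b_k ≥ g_k(u,d, s_k), where γ_{k−1}(u,d) = (g_k(u,d, s_{k−1} u) − g_k(u,d, s_{k−1} d))/(s_{k−1}(u − d)) and β_{k−1}(u,d) = (u · g_k(u,d, s_{k−1} d) − d · g_k(u,d, s_{k−1} u))/((1+r) · b_{k−1} · (u − d)). -/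
/-- The risk-neutral probability `p(u,d) = ((1+r) - d)/(u - d)`. -/
noncomputable def priceP (r u d : ℝ) : ℝ := ((1 + r) - d) / (u - d)

/-- The rational price
`g_k(u,d,s) = (1+r)^{-(n-k)} ∑_{j=0}^{n-k} C(n-k,j) p^j (1-p)^{n-k-j} f(s u^j d^{n-k-j})`. -/
noncomputable def ratPrice (r : ℝ) (n : ℕ) (f : ℝ → ℝ) (u d : ℝ) (k : ℕ) (s : ℝ) : ℝ :=
  ((1 + r) ^ (n - k))⁻¹ *
    ∑ j ∈ Finset.range (n - k + 1),
      (Nat.choose (n - k) j : ℝ) * priceP r u d ^ j * (1 - priceP r u d) ^ (n - k - j) *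
        f (s * u ^ j * d ^ (n - k - j))

/-- The rational price inherits convexity from the payoff. -/
theorem ratPrice_convexOn (r : ℝ) (hr : 0 ≤ r) (n : ℕ) (u d : ℝ)
    (hd : 0 < d) (hdr : d < 1 + r) (hru : 1 + r < u) (f : ℝ → ℝ)
    (hf : ConvexOn ℝ (Set.Ioi (0 : ℝ)) f) (k : ℕ)
    (x y a b : ℝ) (hx : 0 < x) (hy : 0 < y) (ha : 0 ≤ a) (hb : 0 ≤ b) (hab : a + b = 1) :
    ratPrice r n f u d k (a * x + b * y) ≤
      a * ratPrice r n f u d k x + b * ratPrice r n f u d k y := by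
  have hu : 0 < u := by linarith
  have hud : 0 < u - d := by linarith
  have hp0 : 0 ≤ priceP r u d := div_nonneg (by linarith) hud.le
  have hp1 : 0 ≤ 1 - priceP r u d := by
    have : priceP r u d ≤ 1 := by
      unfold priceP
      rw [div_le_one hud]
      linarith
    linarith
  unfold ratPrice
  rw [mul_left_comm a, mul_left_comm b, ← mul_add, Finset.mul_sum _ _ a, Finset.mul_sum _ _ b,
    ← Finset.sum_add_distrib]
  refine mul_le_mul_of_nonneg_left (Finset.sum_le_sum fun j _ => ?_) (by positivity)
  rw [mul_left_comm a, mul_left_comm b, ← mul_add]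
  refine mul_le_mul_of_nonneg_left ?_ (by positivity)
  have hX : x * u ^ j * d ^ (n - k - j) ∈ Set.Ioi (0 : ℝ) := Set.mem_Ioi.2 (by positivity)
  have hY : y * u ^ j * d ^ (n - k - j) ∈ Set.Ioi (0 : ℝ) := Set.mem_Ioi.2 (by positivity)
  have h := hf.2 hX hY ha hb hab
  simp only [smul_eq_mul] at h
  convert h using 2
  ring

/-- For a convex payoff and a jump `ξ ∈ [d,u]`, the liquidation value of the
time-`(k-1)` portfolio is at least the new set-up cost `g_k(u,d,s_k)`. -/
theorem liquidation_value_ge_setup_cost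
    (r : ℝ) (hr : 0 ≤ r) (n : ℕ) (u d : ℝ)
    (hd : 0 < d) (hdr : d < 1 + r) (hru : 1 + r < u) (f : ℝ → ℝ)
    (hf : ConvexOn ℝ (Set.Ioi (0 : ℝ)) f)
    (k : ℕ) (hk1 : 1 ≤ k) (hkn : k ≤ n)
    (sPrev : ℝ) (hs : 0 < sPrev) (b0 : ℝ) (hb0 : 0 < b0)
    (bPrev : ℝ) (hb : bPrev = b0 * (1 + r) ^ (k - 1))
    (ξ : ℝ) (hξd : d ≤ ξ) (hξu : ξ ≤ u)
    (sk bk : ℝ) (hsk : sk = sPrev * ξ) (hbk : bk = bPrev * (1 + r)) :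
    ratPrice r n f u d k sk ≤
      ((ratPrice r n f u d k (sPrev * u) - ratPrice r n f u d k (sPrev * d)) /
          (sPrev * (u - d))) * sk +
        ((u * ratPrice r n f u d k (sPrev * d) - d * ratPrice r n f u d k (sPrev * u)) /
          ((1 + r) * bPrev * (u - d))) * bk := by
  have hud : 0 < u - d := by linarith
  have hu : 0 < u := by linarith
  have hbp : 0 < bPrev := by
    rw [hb]
    positivity
  have h := ratPrice_convexOn r hr n u d hd hdr hru f hf k (sPrev * u) (sPrev * d)
    ((ξ - d) / (u - d)) ((u - ξ) / (u - d)) (by positivity) (by positivity)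
    (div_nonneg (by linarith) hud.le) (div_nonneg (by linarith) hud.le)
    (by field_simp; ring)
  have e : (ξ - d) / (u - d) * (sPrev * u) + (u - ξ) / (u - d) * (sPrev * d) = sk := by
    rw [hsk]
    field_simp
    ring
  rw [e] at h
  refine h.trans (le_of_eq ?_)
  generalize ratPrice r n f u d k (sPrev * u) = A
  generalize ratPrice r n f u d k (sPrev * d) = B
  have hr1 : 0 < 1 + r := by linarith
  rw [hsk, hbk]
  field_simp
  ring
end

section
/- Let f(s) = max(s − K, 0) be the European call payoff with strike K > 0, and let D, U, d, u be real parameters with 0 < D ≤ d < 1 + r < u ≤ U. Then for every k with 0 ≤ k ≤ n and every s > 0, the rational price g_k(u,d,s) lies in the no-arbitrage price interval determined by (U, D): (1+r)^{-(n−k)} · max(s (1+r)^{n−k} − K, 0) ≤ g_k(u,d,s) ≤ g_k(U,D,s). -/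
/-- Undiscounted binomial expectation, defined recursively. -/
noncomputable def binE (f : ℝ → ℝ) (p u d : ℝ) : ℕ → ℝ → ℝ
  | 0, s => f s
  | m + 1, s => p * binE f p u d m (s * u) + (1 - p) * binE f p u d m (s * d)

lemma binE_eq_sum (f : ℝ → ℝ) (p u d : ℝ) (m : ℕ) : ∀ s : ℝ,
    ∑ j ∈ Finset.range (m + 1), (Nat.choose m j : ℝ) * p ^ j * (1 - p) ^ (m - j) *
        f (s * u ^ j * d ^ (m - j)) = binE f p u d m s := by
  induction m with
  | zero => intro s; simp [binE]
  | succ m ih =>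
    intro s
    rw [binE, ← ih, ← ih, Finset.mul_sum, Finset.mul_sum]
    rw [Finset.sum_range_succ']
    have h2 : ∑ j ∈ Finset.range (m + 1), (1 - p) * ((Nat.choose m j : ℝ) * p ^ j *
          (1 - p) ^ (m - j) * f (s * d * u ^ j * d ^ (m - j)))
        = ∑ j ∈ Finset.range (m + 1), (Nat.choose m (j + 1) : ℝ) * p ^ (j + 1) *
          (1 - p) ^ (m - j) * f (s * u ^ (j + 1) * d ^ (m - j))
          + (1 - p) ^ (m + 1) * f (s * d ^ (m + 1)) := by
      rw [Finset.sum_range_succ', Finset.sum_range_succ _ m]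
      simp only [Nat.choose_succ_self, Nat.cast_zero, zero_mul, add_zero]
      congr 1
      · refine Finset.sum_congr rfl fun j hj => ?_
        have hj' := Finset.mem_range.mp hj
        have e : m - j = (m - (j + 1)) + 1 := by omega
        rw [e]
        have e2 : s * d * u ^ (j + 1) * d ^ (m - (j + 1))
          = s * u ^ (j + 1) * d ^ (m - (j + 1) + 1) := by ring
        rw [e2]; ring
      · have e2 : s * d * u ^ 0 * d ^ (m - 0) = s * d ^ (m + 1) := by
          simp only [Nat.sub_zero]; ring
        rw [e2]; simp; ring
    rw [h2, ← add_assoc, ← Finset.sum_add_distrib]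
    congr 1
    · refine Finset.sum_congr rfl fun j hj => ?_
      have e : m + 1 - (j + 1) = m - j := by omega
      have e2 : s * u * u ^ j * d ^ (m - j) = s * u ^ (j + 1) * d ^ (m - j) := by ring
      rw [e, e2, Nat.choose_succ_succ]; push_cast; ring
    · simp

lemma convexOn_scale {f : ℝ → ℝ} (hf : ConvexOn ℝ Set.univ f) (c : ℝ) :
    ConvexOn ℝ Set.univ (fun s => f (s * c)) := by
  refine ⟨convex_univ, fun x _ y _ a b ha hb hab => ?_⟩
  have h := hf.2 (Set.mem_univ (x * c)) (Set.mem_univ (y * c)) ha hb hab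
  simp only [smul_eq_mul] at h ⊢
  rwa [show (a * x + b * y) * c = a * (x * c) + b * (y * c) by ring]

lemma binE_convex {f : ℝ → ℝ} (hf : ConvexOn ℝ Set.univ f) {p : ℝ} (u d : ℝ)
    (hp0 : 0 ≤ p) (hp1 : p ≤ 1) (m : ℕ) : ConvexOn ℝ Set.univ (binE f p u d m) := by
  induction m with
  | zero => exact hf
  | succ m ih =>
    exact ((convexOn_scale ih u).smul hp0).add ((convexOn_scale ih d).smul (sub_nonneg.2 hp1))

lemma two_point {f : ℝ → ℝ} (hf : ConvexOn ℝ Set.univ f) {p P u d U D : ℝ}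
    (hp0 : 0 ≤ p) (hp1 : p ≤ 1) (hDd : D ≤ d) (hdU : d ≤ U) (hDu : D ≤ u) (huU : u ≤ U)
    (hDU : D < U) (hm : p * u + (1 - p) * d = P * U + (1 - P) * D) (s : ℝ) :
    p * f (s * u) + (1 - p) * f (s * d) ≤ P * f (s * U) + (1 - P) * f (s * D) := by
  have hpos : 0 < U - D := by linarith
  have key : ∀ x, D ≤ x → x ≤ U →
      f (s * x) ≤ (x - D) / (U - D) * f (s * U) + (U - x) / (U - D) * f (s * D) := by
    intro x h1 h2
    have h := hf.2 (Set.mem_univ (s * U)) (Set.mem_univ (s * D))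
      (div_nonneg (sub_nonneg.2 h1) hpos.le) (div_nonneg (sub_nonneg.2 h2) hpos.le)
      (by field_simp; ring)
    simp only [smul_eq_mul] at h
    rwa [show (x - D) / (U - D) * (s * U) + (U - x) / (U - D) * (s * D) = s * x by
      field_simp; ring] at h
  have h1 := mul_le_mul_of_nonneg_left (key u hDu huU) hp0
  have h2 := mul_le_mul_of_nonneg_left (key d hDd hdU) (sub_nonneg.2 hp1)
  have hP : P = p * ((u - D) / (U - D)) + (1 - p) * ((d - D) / (U - D)) := by
    field_simp; linarith
  have hQ : 1 - P = p * ((U - u) / (U - D)) + (1 - p) * ((U - d) / (U - D)) := by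
    field_simp; linarith
  rw [hQ]
  nth_rewrite 1 [hP]
  linarith

lemma binE_mono {f : ℝ → ℝ} (hf : ConvexOn ℝ Set.univ f) {p P u d U D : ℝ}
    (hp0 : 0 ≤ p) (hp1 : p ≤ 1) (hP0 : 0 ≤ P) (hP1 : P ≤ 1)
    (hDd : D ≤ d) (hdU : d ≤ U) (hDu : D ≤ u) (huU : u ≤ U)
    (hDU : D < U) (hm : p * u + (1 - p) * d = P * U + (1 - P) * D) (m : ℕ) :
    ∀ s, binE f p u d m s ≤ binE f P U D m s := by
  induction m with
  | zero => intro s; exact le_rfl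
  | succ m ih =>
    intro s
    have h := two_point (binE_convex hf u d hp0 hp1 m) hp0 hp1 hDd hdU hDu huU hDU hm s
    have h1 := mul_le_mul_of_nonneg_left (ih (s * U)) hP0
    have h2 := mul_le_mul_of_nonneg_left (ih (s * D)) (sub_nonneg.2 hP1)
    simp only [binE]
    linarith

lemma binE_lower {f : ℝ → ℝ} (hf : ConvexOn ℝ Set.univ f) {p u d R : ℝ}
    (hp0 : 0 ≤ p) (hp1 : p ≤ 1) (hm : p * u + (1 - p) * d = R) (m : ℕ) :
    ∀ s, f (s * R ^ m) ≤ binE f p u d m s := by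
  induction m with
  | zero => intro s; simp [binE]
  | succ m ih =>
    intro s
    have h := hf.2 (Set.mem_univ (s * u * R ^ m)) (Set.mem_univ (s * d * R ^ m)) hp0
      (sub_nonneg.2 hp1) (by ring)
    simp only [smul_eq_mul] at h
    rw [show p * (s * u * R ^ m) + (1 - p) * (s * d * R ^ m) = s * R ^ (m + 1) by
      rw [pow_succ]; nth_rewrite 4 [← hm]; ring] at h
    have h1 := mul_le_mul_of_nonneg_left (ih (s * u)) hp0
    have h2 := mul_le_mul_of_nonneg_left (ih (s * d)) (sub_nonneg.2 hp1)
    simp only [binE]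
    linarith

lemma call_convex (K : ℝ) : ConvexOn ℝ Set.univ (fun x : ℝ => max (x - K) 0) := by
  have h1 : ConvexOn ℝ Set.univ (fun x : ℝ => x - K) :=
    (convexOn_id convex_univ).sub (concaveOn_const K convex_univ)
  exact h1.sup (convexOn_const 0 convex_univ)

lemma priceP_facts {r u d : ℝ} (hdr : d < 1 + r) (hru : 1 + r < u) :
    0 ≤ priceP r u d ∧ priceP r u d ≤ 1 ∧
      priceP r u d * u + (1 - priceP r u d) * d = 1 + r := by
  have h : 0 < u - d := by linarith
  unfold priceP
  refine ⟨div_nonneg (by linarith) h.le, (div_le_one h).2 (by linarith), ?_⟩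
  field_simp; ring

lemma ratPrice_eq (r : ℝ) (n : ℕ) (f : ℝ → ℝ) (u d : ℝ) (k : ℕ) (s : ℝ) :
    ratPrice r n f u d k s = ((1 + r) ^ (n - k))⁻¹ * binE f (priceP r u d) u d (n - k) s := by
  unfold ratPrice
  rw [binE_eq_sum]

/-- For the European call, the rational price `g_k(u,d,s)` lies in the
no-arbitrage price interval determined by `(U,D)`. -/
theorem ratPrice_in_no_arbitrage_interval
    (r : ℝ) (hr : 0 ≤ r) (n : ℕ) (U D u d : ℝ)
    (hD : 0 < D) (hDd : D ≤ d) (hdr : d < 1 + r) (hru : 1 + r < u) (huU : u ≤ U)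
    (K : ℝ) (hK : 0 < K) :
    ∀ k : ℕ, k ≤ n → ∀ s : ℝ, 0 < s →
      ((1 + r) ^ (n - k))⁻¹ * max (s * (1 + r) ^ (n - k) - K) 0 ≤
          ratPrice r n (fun x => max (x - K) 0) u d k s ∧
        ratPrice r n (fun x => max (x - K) 0) u d k s ≤
          ratPrice r n (fun x => max (x - K) 0) U D k s := by
  intro k _ s _
  obtain ⟨p0, p1, pm⟩ := priceP_facts hdr hru
  obtain ⟨P0, P1, Pm⟩ := priceP_facts (r := r) (u := U) (d := D) (by linarith) (by linarith)
  have hR : 0 ≤ ((1 + r) ^ (n - k))⁻¹ := by positivity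
  rw [ratPrice_eq, ratPrice_eq]
  refine ⟨mul_le_mul_of_nonneg_left ?_ hR, mul_le_mul_of_nonneg_left ?_ hR⟩
  · exact binE_lower (call_convex K) p0 p1 pm (n - k) s
  · exact binE_mono (call_convex K) p0 p1 P0 P1 hDd (by linarith) (by linarith) huU
      (by linarith) (pm.trans Pm.symm) (n - k) s
end
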